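/- Let n ≥ 1, σ > 0 and z, y ∈ ℝⁿ, and let f = ∏_{i=1}^n (2πσ²)^{-1/2} exp(−(z_i−y_i)²/(2σ²)) be the value at z of the multivariate normal density with mean y and covariance σ²Iₙ. Let C ≥ 0 (the value of the covariance penalized error CPE(z,ŷ)), assume f ≠ 1, and set r = C/(2 log f) + 1. Then for every real g ≥ 0 (the value of the product of the remaining model densities π(y|θ,b)π(θ)π(b)h(z,θ,b)), the Lebesgue integral over u ∈ (0,1) satisfies ∫₀¹ f^r · g · 1{C < −2 log u} du = f · g. In other words, every Bayesian joint density for normal data is the average over u ~ Uniform(0,1) of the CPE-truncated density f^r π(y|θ,b)π(θ)π(b) 1{CPE < κ*} h with κ* = −2 log u. -/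

import Mathlib

open MeasureTheory Real

/-- Pointwise content of Theorem 1: every Bayesian joint density for normal data is the
average over `u ~ Uniform(0,1)` of the CPE-truncated density with `κ* = -2 log u`. -/
theorem truncated_cpe_representation
    (n : ℕ) (hn : 1 ≤ n) (σ : ℝ) (hσ : 0 < σ) (z y : Fin n → ℝ)
    (f : ℝ)
    (hf : f = ∏ i, (2 * π * σ ^ 2) ^ (-(1 : ℝ) / 2) * Real.exp (-(z i - y i) ^ 2 / (2 * σ ^ 2)))
    (C : ℝ) (hC : 0 ≤ C) (hf1 : f ≠ 1)
    (r : ℝ) (hr : r = C / (2 * Real.log f) + 1)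
    (g : ℝ) (hg : 0 ≤ g) :
    ∫ u in Set.Ioo (0 : ℝ) 1,
        f ^ r * g * (if C < -2 * Real.log u then (1 : ℝ) else 0) = f * g := by
  have hfpos : 0 < f := by
    rw [hf]
    refine Finset.prod_pos fun i _ => ?_
    have := Real.pi_pos
    positivity
  have hlog : Real.log f ≠ 0 := Real.log_ne_zero_of_pos_of_ne_one hfpos hf1
  have hfr : f ^ r = Real.exp (C / 2) * f := by
    rw [Real.rpow_def_of_pos hfpos]
    have h : Real.log f * r = C / 2 + Real.log f := by
      rw [hr]; field_simp
    rw [h, Real.exp_add, Real.exp_log hfpos]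
  have hind : ∫ u in Set.Ioo (0 : ℝ) 1, (if C < -2 * Real.log u then (1 : ℝ) else 0)
      = Real.exp (-(C / 2)) := by
    have h1 : ∫ u in Set.Ioo (0 : ℝ) 1, (if C < -2 * Real.log u then (1 : ℝ) else 0)
        = ∫ u in Set.Ioo (0 : ℝ) 1,
          (Set.Iio (Real.exp (-(C / 2)))).indicator (fun _ => (1 : ℝ)) u := by
      refine setIntegral_congr_fun measurableSet_Ioo fun u hu => ?_
      have h2 : C < -2 * Real.log u ↔ u < Real.exp (-(C / 2)) := by
        rw [← Real.log_lt_iff_lt_exp hu.1]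
        constructor <;> intro h <;> linarith
      simp only [Set.indicator_apply, Set.mem_Iio, h2]
    have hle : Real.exp (-(C / 2)) ≤ 1 := Real.exp_le_one_iff.mpr (by linarith)
    rw [h1, setIntegral_indicator measurableSet_Iio, Set.Ioo_inter_Iio, min_eq_right hle]
    simp [(Real.exp_pos _).le]
  rw [integral_const_mul, hind, hfr, Real.exp_neg]
  have := (Real.exp_pos (C / 2)).ne'
  field_simp
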